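/- Let n ≥ 1 and b₁, …, bₙ ∈ ℝ, and let f(y) = Σ_{i=1}^{n} bᵢ yⁱ. Consider the loop L_f on ℝ³ with multiplication (x₁,y₁,z₁) ∗ (x₂,y₂,z₂) = (x₁+x₂, y₁+y₂, z₁+z₂ − x₂·f(y₁) + (1/2)x₂²·y₁). Then the subgroup of the permutation group of ℝ³ generated by all left translations λ_a : x ↦ a ∗ x and all right translations ρ_a : x ↦ x ∗ a, a ∈ ℝ³, is a nilpotent group. -/

import Mathlib

open Finset

/-- The loop multiplication on `ℝ³` of the loop `L_f` with `f(y) = Σ_{i=1}^{n} bᵢ yⁱ`: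
`(x₁,y₁,z₁) ∗ (x₂,y₂,z₂) = (x₁+x₂, y₁+y₂, z₁+z₂ − x₂·f(y₁) + ½ x₂²·y₁)`. -/
noncomputable def loopMul (n : ℕ) (b : ℕ → ℝ) (p q : ℝ × ℝ × ℝ) : ℝ × ℝ × ℝ :=
  (p.1 + q.1, p.2.1 + q.2.1,
    p.2.2 + q.2.2 - q.1 * (∑ i ∈ Icc 1 n, b i * p.2.1 ^ i) + (1/2) * q.1 ^ 2 * p.2.1)

/-- `F` is annihilated by any `k` successive difference operators. -/
def IsPolyMap {A B : Type*} [AddCommGroup A] [AddCommGroup B] : ℕ → (A → B) → Prop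
  | 0, F => ∀ u, F u = 0
  | k + 1, F => ∀ v, IsPolyMap k fun u => F (u + v) - F u

namespace IsPolyMap

variable {A B : Type*} [AddCommGroup A] [AddCommGroup B] {k l : ℕ} {F G : A → B}

theorem add (hF : IsPolyMap k F) (hG : IsPolyMap k G) : IsPolyMap k fun u => F u + G u := by
  induction k generalizing F G with
  | zero => intro u; simp [hF u, hG u]
  | succ k ih =>
    intro v
    convert ih (hF v) (hG v) using 2
    dsimp only
    abel

theorem neg (hF : IsPolyMap k F) : IsPolyMap k fun u => -F u := by
  induction k generalizing F with
  | zero => intro u; simp [hF u]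
  | succ k ih =>
    intro v
    convert ih (hF v) using 2
    dsimp only
    abel

theorem comp_add_right (hF : IsPolyMap k F) (w : A) : IsPolyMap k fun u => F (u + w) := by
  induction k generalizing F with
  | zero => intro u; exact hF _
  | succ k ih =>
    intro v
    convert ih (hF v) using 4
    abel

theorem comp_addMonoidHom {A' : Type*} [AddCommGroup A'] (hF : IsPolyMap k F) (φ : A' →+ A) :
    IsPolyMap k fun u => F (φ u) := by
  induction k generalizing F with
  | zero => intro u; exact hF _
  | succ k ih =>
    intro v
    simpa only [map_add] using ih (hF (φ v))

theorem succ (hF : IsPolyMap k F) : IsPolyMap (k + 1) F := by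
  induction k generalizing F with
  | zero => intro v u; simp [hF _]
  | succ k ih => exact fun v => ih (hF v)

theorem mono (hF : IsPolyMap k F) (h : k ≤ l) : IsPolyMap l F := by
  induction h with
  | refl => exact hF
  | step _ ih => exact ih.succ

end IsPolyMap

theorem Polynomial.isPolyMap_eval {R : Type*} [CommRing R] {k : ℕ} {p : Polynomial R}
    (hp : p.degree < k) : IsPolyMap k fun x => p.eval x := by
  induction k generalizing p with
  | zero =>
    intro u
    have : p = 0 := by simpa [Polynomial.degree_eq_bot] using Nat.WithBot.lt_zero_iff.mp hp
    simp [this]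
  | succ k ih =>
    intro v
    have hdeg : (Polynomial.taylor v p - p).degree < k := by
      rcases eq_or_ne p 0 with rfl | h0
      · simp
      · refine (Polynomial.degree_sub_lt_left (Polynomial.degree_taylor p v) ?_ ?_).trans_le ?_
        · simpa using h0
        · simp
        · rw [Polynomial.degree_eq_natDegree h0] at hp
          rw [Polynomial.degree_taylor, Polynomial.degree_eq_natDegree h0]
          exact_mod_cast Nat.lt_succ_iff.mp (by exact_mod_cast hp)
    simpa [Polynomial.taylor_eval] using ih hdeg

/-- `σ` translates the first two coordinates by `v` and the last one by `F` of the first two. -/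
def IsShear (σ : Equiv.Perm (ℝ × ℝ × ℝ)) (v : ℝ × ℝ) (F : ℝ × ℝ → ℝ) : Prop :=
  ∀ x y z, σ (x, y, z) = (x + v.1, y + v.2, z + F (x, y))

namespace IsShear

variable {σ τ : Equiv.Perm (ℝ × ℝ × ℝ)} {v w : ℝ × ℝ} {F G : ℝ × ℝ → ℝ}

theorem mul (hσ : IsShear σ v F) (hτ : IsShear τ w G) :
    IsShear (σ * τ) (v + w) fun u => G u + F (u + w) := by
  intro x y z
  obtain ⟨w₁, w₂⟩ := w
  rw [Equiv.Perm.mul_apply, hτ, hσ]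
  ext <;> simp <;> ring

theorem inv (hσ : IsShear σ v F) : IsShear σ⁻¹ (-v) fun u => -F (u + -v) := by
  intro x y z
  obtain ⟨v₁, v₂⟩ := v
  rw [Equiv.Perm.inv_eq_iff_eq, hσ]
  ext <;> simp

/-- A commutator with a shear fixing the first two coordinates differentiates it. -/
theorem commutator (hσ : IsShear σ 0 F) (hτ : IsShear τ w G) :
    IsShear (σ * τ * σ⁻¹ * τ⁻¹) 0 fun u => -(F (u + -w) - F u) := by
  intro x y z
  rw [((hσ.mul hτ).mul hσ.inv).mul hτ.inv]
  ext <;> simp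
  ring

end IsShear

theorem mem_upperCentralSeries_of_isShear {H : Subgroup (Equiv.Perm (ℝ × ℝ × ℝ))}
    (hH : ∀ τ ∈ H, ∃ w G, IsShear τ w G) {k : ℕ} {σ : H} {F : ℝ × ℝ → ℝ}
    (hσ : IsShear σ 0 F) (hF : IsPolyMap k F) : σ ∈ Subgroup.upperCentralSeries H k := by
  induction k generalizing σ F with
  | zero =>
    rw [Subgroup.upperCentralSeries_zero, Subgroup.mem_bot]
    ext1
    ext1 ⟨x, y, z⟩
    rw [hσ, hF]
    simp
  | succ k ih =>
    rw [Subgroup.mem_upperCentralSeries_succ_iff]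
    intro τ
    obtain ⟨w, G, hτ⟩ := hH τ τ.2
    exact ih (hσ.commutator hτ) (hF (-w)).neg

theorem isNilpotent_of_isShear {H : Subgroup (Equiv.Perm (ℝ × ℝ × ℝ))} {k : ℕ}
    (hH : ∀ τ ∈ H, ∃ w G, IsShear τ w G ∧ IsPolyMap k G) : Group.IsNilpotent H := by
  refine ⟨k + 1, (Subgroup.eq_top_iff' _).mpr fun σ => ?_⟩
  rw [Subgroup.mem_upperCentralSeries_succ_iff]
  intro τ
  obtain ⟨v, F, hσ, hF⟩ := hH σ σ.2
  obtain ⟨w, G, hτ, hG⟩ := hH τ τ.2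
  have h := ((hσ.mul hτ).mul hσ.inv).mul hτ.inv
  rw [show v + w + -v + -w = 0 by abel] at h
  refine mem_upperCentralSeries_of_isShear (fun τ hτ => ?_) h ?_
  · obtain ⟨w, G, h, -⟩ := hH τ hτ
    exact ⟨w, G, h⟩
  · exact (hG.comp_add_right _).neg.add
      (((hF.comp_add_right _).neg.add
        ((hG.add (hF.comp_add_right _)).comp_add_right _)).comp_add_right _)

theorem isNilpotent_closure_of_isShear {S : Set (Equiv.Perm (ℝ × ℝ × ℝ))} {k : ℕ}
    (hS : ∀ τ ∈ S, ∃ w G, IsShear τ w G ∧ IsPolyMap k G) :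
    Group.IsNilpotent (Subgroup.closure S) := by
  refine isNilpotent_of_isShear (k := k) fun τ hτ => ?_
  induction hτ using Subgroup.closure_induction with
  | mem τ hτ => exact hS τ hτ
  | one =>
    exact ⟨0, fun _ => 0, fun x y z => by simp,
      IsPolyMap.mono (k := 0) (fun _ => rfl) (Nat.zero_le k)⟩
  | mul σ τ _ _ hσ hτ =>
    obtain ⟨v, F, hσ, hF⟩ := hσ
    obtain ⟨w, G, hτ, hG⟩ := hτ
    exact ⟨_, _, hσ.mul hτ, hG.add (hF.comp_add_right w)⟩
  | inv σ _ hσ =>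
    obtain ⟨v, F, hσ, hF⟩ := hσ
    exact ⟨_, _, hσ.inv, (hF.comp_add_right _).neg⟩

open Polynomial in
/-- For `n ≥ 1` and `f(y) = Σ_{i=1}^{n} bᵢ yⁱ`, the multiplication group of the loop
`L_f`, i.e. the subgroup of the permutation group of `ℝ³` generated by all left
translations `λ_a : x ↦ a ∗ x` and all right translations `ρ_a : x ↦ x ∗ a`, is a
nilpotent group. -/
theorem multiplication_group_nilpotent (n : ℕ) (hn : 1 ≤ n) (b : ℕ → ℝ) :
    Group.IsNilpotent
      ↥(Subgroup.closure {σ : Equiv.Perm (ℝ × ℝ × ℝ) |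
        ∃ a : ℝ × ℝ × ℝ, (∀ x, σ x = loopMul n b a x) ∨ (∀ x, σ x = loopMul n b x a)}) := by
  have key (p : ℝ[X]) (φ : ℝ × ℝ →+ ℝ) (hp : p.natDegree ≤ n + 2) :
      IsPolyMap (n + 3) fun u => p.eval (φ u) :=
    (p.isPolyMap_eval (lt_of_le_of_lt degree_le_natDegree
      (by exact_mod_cast Nat.lt_succ_of_le hp))).comp_addMonoidHom φ
  refine isNilpotent_closure_of_isShear (k := n + 3) ?_
  rintro σ ⟨⟨a₁, a₂, a₃⟩, h | h⟩
  · refine ⟨(a₁, a₂), _, fun x y z => ?_,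
      key (C a₃ - X * C (∑ i ∈ Icc 1 n, b i * a₂ ^ i) + C (1 / 2 * a₂) * X ^ 2)
        (AddMonoidHom.fst ℝ ℝ) ?_⟩
    · rw [h]
      ext <;> simp [loopMul, eval_finsetSum] <;> ring
    · exact le_trans (by compute_degree) (Nat.le_add_left 2 n)
  · refine ⟨(a₁, a₂), _, fun x y z => ?_,
      key (C a₃ - C a₁ * ∑ i ∈ Icc 1 n, C (b i) * X ^ i + C (1 / 2 * a₁ ^ 2) * X)
        (AddMonoidHom.snd ℝ ℝ) ?_⟩
    · rw [h]
      ext <;> simp [loopMul, eval_finsetSum]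
      ring
    · have hsum : (∑ i ∈ Icc 1 n, C (b i) * X ^ i : ℝ[X]).natDegree ≤ n :=
        natDegree_sum_le_of_forall_le _ _ fun i hi =>
          (natDegree_C_mul_X_pow_le _ _).trans (mem_Icc.mp hi).2
      refine natDegree_add_le_of_degree_le
        ((natDegree_sub_le_of_le ?_ ?_).trans (max_self (n + 2)).le) ?_
      · simp
      · exact (natDegree_C_mul_le _ _).trans (hsum.trans (Nat.le_add_right n 2))
      · exact (natDegree_C_mul_le _ _).trans (natDegree_X_le.trans (by omega))
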